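/- Let T1 and T2 be path covers of G with T1 \ T2 = {(v3,v4)} and T2 \ T1 = {(v0,v1)}, where v1, v2, v3, v4 are distinct, v0 ∉ {v1, v2, v3} (the case v0 = v4 is allowed), the two-edge path {(v1,v2), (v2,v3)} belongs to 𝒫(T1 ∩ T2), and 𝒫(T1) ∩ 𝒫(T2) ≠ ∅. Then there exist edge sets B1, B2 ⊆ E with B1 ∩ B2 = ∅ such that: (i) T_i ∪ B_i is a tour of G for i = 1,2; (ii) V(B_i) = V1(T_i) for i = 1,2; and (iii) B1 ∪ B2 consists of a (v1, v3)-path if v0 = v4, and, if v0 ≠ v4, of either vertex-disjoint (v0, v3)- and (v1, v4)-paths or vertex-disjoint (v0, v1)- and (v3, v4)-paths. Moreover, for any chosen common path O1 ∈ 𝒫(T1) ∩ 𝒫(T2) and any prescribed labeling (z1, w1) of its two endpoints, the sets B1 and B2 can be chosen so that (v1, z1) ∈ B1 and (v3, w1) ∈ B2. -/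

import Mathlib

variable {V : Type*} [Fintype V] [DecidableEq V]

/-- The degree of vertex `v` in the edge set `F`. -/
def degE (F : Finset (Sym2 V)) (v : V) : ℕ := (F.filter (fun e => v ∈ e)).card

/-- The set of vertices incident to an edge of `F`. -/
def VsetE (F : Finset (Sym2 V)) : Set V := {v | ∃ e ∈ F, v ∈ e}

/-- Vertices incident to exactly one edge of `F`. -/
def V1E (F : Finset (Sym2 V)) : Set V := {v | degE F v = 1}

/-- Vertices incident to exactly two edges of `F`. -/
def V2E (F : Finset (Sym2 V)) : Set V := {v | degE F v = 2}

/-- All edges are genuine edges of the complete graph (no loops). -/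
def SimpleE (F : Finset (Sym2 V)) : Prop := ∀ e ∈ F, ¬ e.IsDiag

/-- `F` is spanning: every vertex is incident to an edge of `F`. -/
def SpanningE (F : Finset (Sym2 V)) : Prop := VsetE F = Set.univ

/-- `F` is a `k`-matching: every vertex has at most `k` incident edges. -/
def IsKMatching (k : ℕ) (F : Finset (Sym2 V)) : Prop :=
  SimpleE F ∧ ∀ v : V, degE F v ≤ k

/-- `F` is a `k`-factor: every vertex has exactly `k` incident edges. -/
def IsKFactor (k : ℕ) (F : Finset (Sym2 V)) : Prop :=
  SimpleE F ∧ ∀ v : V, degE F v = k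

/-- `F` is the edge set of a single (simple) cycle. -/
def IsCycleE (F : Finset (Sym2 V)) : Prop :=
  ∃ m : ℕ, 3 ≤ m ∧ ∃ f : ℕ → V,
    (∀ i < m, ∀ j < m, f i = f j → i = j) ∧
    F = (Finset.range m).image (fun i => s(f i, f ((i + 1) % m)))

/-- `F` contains no cycle. -/
def AcyclicE (F : Finset (Sym2 V)) : Prop :=
  ∀ C : Finset (Sym2 V), C ⊆ F → ¬ IsCycleE C

/-- `F` is the edge set of a simple path with endpoints `a` and `b`. -/
def IsPathE (F : Finset (Sym2 V)) (a b : V) : Prop :=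
  ∃ m : ℕ, 1 ≤ m ∧ ∃ f : ℕ → V,
    (∀ i ≤ m, ∀ j ≤ m, f i = f j → i = j) ∧ f 0 = a ∧ f m = b ∧
    F = (Finset.range m).image (fun i => s(f i, f (i + 1)))

/-- `P` is a maximal path of `F`, i.e. `P ∈ 𝒫(F)`. -/
def MaxPathE (F P : Finset (Sym2 V)) : Prop :=
  P ⊆ F ∧ (∃ a b : V, IsPathE P a b) ∧
  ∀ e ∈ F, (∃ v : V, v ∈ e ∧ v ∈ VsetE P) → e ∈ P

/-- `F` is a path cover: a spanning acyclic 2-matching. -/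
def IsPathCoverE (F : Finset (Sym2 V)) : Prop :=
  IsKMatching 2 F ∧ SpanningE F ∧ AcyclicE F

/-- `F` is a tour: the edge set of a Hamiltonian cycle. -/
def IsTourE (F : Finset (Sym2 V)) : Prop :=
  IsCycleE F ∧ SpanningE F

/-- Total length of the edge set `F`. -/
def lenE (ℓ : Sym2 V → ℝ) (F : Finset (Sym2 V)) : ℝ := ∑ e ∈ F, ℓ e

/-- Minimum length of a tour. -/
noncomputable def optE (ℓ : Sym2 V → ℝ) : ℝ :=
  sInf {x | ∃ H : Finset (Sym2 V), IsTourE H ∧ lenE ℓ H = x}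

/-- Maximum length of a tour. -/
noncomputable def worE (ℓ : Sym2 V → ℝ) : ℝ :=
  sSup {x | ∃ H : Finset (Sym2 V), IsTourE H ∧ lenE ℓ H = x}

/-- The set of edges of `F` incident to `v`. -/
def deltaE (F : Finset (Sym2 V)) (v : V) : Finset (Sym2 V) :=
  F.filter (fun e => v ∈ e)

/-- `(S, T)` is a valid pair of spanning 2-matchings. -/
def ValidPairE (S T : Finset (Sym2 V)) : Prop :=
  IsKMatching 2 S ∧ IsKMatching 2 T ∧ SpanningE S ∧ SpanningE T ∧
  AcyclicE T ∧
  (∀ v : V, v ∈ V2E S → v ∈ V2E T → deltaE S v = deltaE T v) ∧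
  (∀ C : Finset (Sym2 V), C ⊆ S → IsCycleE C →
    ∀ P : Finset (Sym2 V), MaxPathE T P → VsetE C ≠ VsetE P)


set_option linter.unusedSectionVars false

/-- The set of edges joining consecutive entries of a list. -/
def pathEdges : List V → Finset (Sym2 V)
  | [] => ∅
  | [_] => ∅
  | a :: b :: l => insert s(a, b) (pathEdges (b :: l))

/-- A path on at least two vertices, given as (first vertex, interior, last vertex). -/
abbrev Segment (V : Type*) := V × List V × V

namespace Segment

/-- The vertices of a segment in order. -/
def verts (t : Segment V) : List V := t.1 :: (t.2.1 ++ [t.2.2])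

/-- The same segment traversed backwards. -/
def turn (t : Segment V) : Segment V := (t.2.2, t.2.1.reverse, t.1)

/-- All vertices of a list of segments. -/
def allVerts (L : List (Segment V)) : List V := L.flatMap verts

/-- The endpoints of a list of segments. -/
def ends (L : List (Segment V)) : List V := L.flatMap fun t => [t.1, t.2.2]

/-- The union of the edge sets of a list of segments. -/
def edges : List (Segment V) → Finset (Sym2 V)
  | [] => ∅
  | t :: L => pathEdges (verts t) ∪ edges L

/-- The edges that link `a`, the consecutive segments of `L`, and `c` into one path. -/
def links : List (Segment V) → V → V → Finset (Sym2 V)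
  | [], a, c => {s(a, c)}
  | t :: L, a, c => insert s(a, t.1) (links L t.2.2 c)

end Segment

open Segment

theorem pathEdges_append (l₁ l₂ : List V) (x y : V) :
    pathEdges (l₁ ++ x :: y :: l₂) =
      pathEdges (l₁ ++ [x]) ∪ insert s(x, y) (pathEdges (y :: l₂)) := by
  induction l₁ with
  | nil => simp [pathEdges]
  | cons a l ih =>
    cases l with
    | nil => simp [pathEdges, Finset.insert_comm]
    | cons b l =>
      simp only [pathEdges, List.cons_append] at ih ⊢
      rw [ih, Finset.insert_union]

theorem pathEdges_reverse (l : List V) : pathEdges l.reverse = pathEdges l := by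
  induction l with
  | nil => rfl
  | cons a l ih =>
    cases l with
    | nil => rfl
    | cons b l =>
      have h := pathEdges_append l.reverse [] b a
      simp only [List.reverse_cons, List.append_assoc, List.cons_append, List.nil_append] at ih h ⊢
      rw [h, ih]
      ext e
      simp [pathEdges, Sym2.eq_swap (a := a), or_comm]

theorem mem_of_mem_pathEdges {l : List V} {e : Sym2 V} {v : V} (he : e ∈ pathEdges l)
    (hv : v ∈ e) : v ∈ l := by
  induction l with
  | nil => simp [pathEdges] at he
  | cons a l ih =>
    cases l with
    | nil => simp [pathEdges] at he
    | cons b l =>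
      simp only [pathEdges, Finset.mem_insert] at he
      rcases he with rfl | he
      · simp only [Sym2.mem_iff] at hv
        rcases hv with rfl | rfl <;> simp
      · exact List.mem_cons_of_mem _ (ih he)

theorem mem_VsetE_pathEdges (a b : V) (l : List V) (v : V) :
    v ∈ VsetE (pathEdges (a :: b :: l)) ↔ v ∈ a :: b :: l := by
  refine ⟨fun ⟨e, he, hv⟩ => mem_of_mem_pathEdges he hv, fun hv => ?_⟩
  induction l generalizing a b with
  | nil =>
    refine ⟨s(a, b), by simp [pathEdges], ?_⟩
    simpa using hv
  | cons c l ih =>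
    rcases List.mem_cons.1 hv with rfl | hv
    · exact ⟨s(v, b), by simp [pathEdges], by simp⟩
    · obtain ⟨e, he, hve⟩ := ih b c hv
      exact ⟨e, Finset.mem_insert_of_mem he, hve⟩

theorem mem_VsetE_verts (t : Segment V) (v : V) :
    v ∈ VsetE (pathEdges (verts t)) ↔ v ∈ verts t := by
  obtain ⟨z, m, w⟩ := t
  cases m <;> exact mem_VsetE_pathEdges _ _ _ _

theorem mem_VsetE_union (F G : Finset (Sym2 V)) (v : V) :
    v ∈ VsetE (F ∪ G) ↔ v ∈ VsetE F ∨ v ∈ VsetE G := by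
  simp only [VsetE, Set.mem_ofPred_eq, Finset.mem_union]
  grind

theorem mem_VsetE_insert (F : Finset (Sym2 V)) (x y v : V) :
    v ∈ VsetE (insert s(x, y) F) ↔ v = x ∨ v = y ∨ v ∈ VsetE F := by
  simp [VsetE, or_assoc]

theorem mem_VsetE_singleton (x y v : V) :
    v ∈ VsetE ({s(x, y)} : Finset (Sym2 V)) ↔ v = x ∨ v = y := by
  simp [VsetE]

theorem mem_edges {L : List (Segment V)} {e : Sym2 V} :
    e ∈ edges L ↔ ∃ t ∈ L, e ∈ pathEdges (verts t) := by
  induction L with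
  | nil => simp [edges]
  | cons t L ih => simp [edges, ih]

theorem mem_VsetE_edges (L : List (Segment V)) (v : V) :
    v ∈ VsetE (edges L) ↔ v ∈ allVerts L := by
  induction L with
  | nil => simp [VsetE, edges, allVerts]
  | cons t L ih =>
    rw [edges, mem_VsetE_union, mem_VsetE_verts, ih]
    simp [allVerts]

theorem edges_perm {L L' : List (Segment V)} (h : L.Perm L') : edges L = edges L' := by
  ext e
  simp [mem_edges, h.mem_iff]

theorem allVerts_perm {L L' : List (Segment V)} (h : L.Perm L') :
    (allVerts L).Perm (allVerts L') := h.flatMap_right _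

theorem verts_turn (t : Segment V) : verts (turn t) = (verts t).reverse := by
  simp [verts, turn]

theorem pathEdges_turn (t : Segment V) : pathEdges (verts (turn t)) = pathEdges (verts t) := by
  rw [verts_turn, pathEdges_reverse]

theorem edges_map_turn (L : List (Segment V)) : edges (L.map turn) = edges L := by
  induction L with
  | nil => rfl
  | cons t L ih => simp [edges, ih, pathEdges_turn]

theorem allVerts_map_turn (L : List (Segment V)) :
    (allVerts (L.map turn)).Perm (allVerts L) := by
  induction L with
  | nil => simp [allVerts]
  | cons t L ih =>
    simp only [allVerts, List.map_cons, List.flatMap_cons, verts_turn] at ih ⊢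
    exact (List.reverse_perm _).append ih

theorem mem_ends_map_turn (L : List (Segment V)) (v : V) :
    v ∈ ends (L.map turn) ↔ v ∈ ends L := by
  simp only [ends, List.mem_flatMap, List.mem_map, List.mem_cons, List.not_mem_nil, or_false,
    exists_exists_and_eq_and, turn]
  grind

theorem ends_subperm (L : List (Segment V)) : (ends L).Sublist (allVerts L) := by
  induction L with
  | nil => simp [allVerts, ends]
  | cons t L ih =>
    simp only [allVerts, ends, List.flatMap_cons, verts] at ih ⊢
    refine List.Sublist.append ?_ ih
    simp

theorem mem_VsetE_links (L : List (Segment V)) (a c v : V) :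
    v ∈ VsetE (links L a c) ↔ v = a ∨ v = c ∨ v ∈ ends L := by
  induction L generalizing a with
  | nil => simp [links, mem_VsetE_singleton, ends]
  | cons t L ih =>
    rw [links, mem_VsetE_insert, ih]
    simp [ends]
    grind

/-- Linking the segments of `L` yields a single path. -/
theorem pathEdges_links (L : List (Segment V)) (a c : V) (r : List V) :
    pathEdges (a :: (allVerts L ++ c :: r)) =
      edges L ∪ (links L a c ∪ pathEdges (c :: r)) := by
  induction L generalizing a with
  | nil => simp [allVerts, edges, links, pathEdges]
  | cons t L ih =>
    obtain ⟨z, m, w⟩ := t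
    have h : ∀ l : List V, l ≠ [] → pathEdges (z :: (m ++ w :: l)) =
        pathEdges (z :: (m ++ [w])) ∪ pathEdges (w :: l) := by
      intro l hl
      obtain ⟨y, l, rfl⟩ := List.exists_cons_of_ne_nil hl
      exact pathEdges_append (z :: m) l w y
    have h' := h (allVerts L ++ c :: r) (by simp)
    rw [ih] at h'
    simp only [allVerts, List.flatMap_cons, verts, links, edges, pathEdges, List.cons_append,
      List.append_assoc, List.nil_append] at h' ⊢
    rw [h']
    ext e
    simp only [Finset.mem_insert, Finset.mem_union]
    tauto

/-- The links of `L` and of its flipped version form two alternating paths. -/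
theorem exists_links_union (L : List (Segment V)) (a b c d : V) (r s : List V) :
    ∃ p q : List V, (p ++ q).Perm (ends L) ∧
      ((links L a c ∪ pathEdges (c :: r)) ∪ (links (L.map turn) b d ∪ pathEdges (d :: s)) =
          pathEdges (a :: (p ++ c :: r)) ∪ pathEdges (b :: (q ++ d :: s)) ∨
        (links L a c ∪ pathEdges (c :: r)) ∪ (links (L.map turn) b d ∪ pathEdges (d :: s)) =
          pathEdges (a :: (p ++ d :: s)) ∪ pathEdges (b :: (q ++ c :: r))) := by
  induction L generalizing a b with
  | nil => exact ⟨[], [], by simp [ends], Or.inl (by simp [links, pathEdges])⟩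
  | cons t L ih =>
    obtain ⟨z, m, w⟩ := t
    obtain ⟨p, q, hpq, h⟩ := ih w z
    refine ⟨z :: q, w :: p, ?_, h.symm.imp ?_ ?_⟩
    · simp only [ends, List.flatMap_cons, List.cons_append, List.nil_append] at hpq ⊢
      exact (List.perm_middle.trans ((List.perm_append_comm.trans hpq).cons w)).cons z
    all_goals
      intro h
      simp only [links, List.map_cons, turn, List.cons_append, pathEdges] at h ⊢
      rw [Finset.ext_iff] at h ⊢
      intro e
      have := h e
      simp only [Finset.mem_insert, Finset.mem_union] at this ⊢
      grind

theorem disjoint_links (L : List (Segment V)) (a b c d : V)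
    (hab : a ≠ b) (ha : a ∉ ends L) (hb : b ∉ ends L) (hL : (ends L).Nodup)
    (hc : c ∉ ends L) (hd : d ∉ ends L) (had : a ≠ d) (hbc : b ≠ c) :
    Disjoint (links L a c) (links (L.map turn) b d) := by
  induction L generalizing a b with
  | nil =>
    simp [links]
    grind
  | cons t L ih =>
    obtain ⟨z, m, w⟩ := t
    simp only [ends, List.flatMap_cons, List.cons_append, List.nil_append, List.mem_cons,
      List.nodup_cons, not_or] at ha hb hL hc hd ih
    have ih := ih w z (Ne.symm hL.1.1) hL.2.1 hL.1.2 hL.2.2 hc.2.2 hd.2.2 (Ne.symm hd.2.1)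
      (Ne.symm hc.1)
    simp only [links, List.map_cons, turn, Finset.disjoint_insert_left,
      Finset.disjoint_insert_right, Finset.mem_insert, not_or]
    refine ⟨⟨?_, fun h => ?_⟩, fun h => ?_, ih⟩
    · simp
      grind
    · have := (mem_VsetE_links L w c b).1 ⟨_, h, Sym2.mem_mk_left _ _⟩
      simp only [ends] at this
      grind
    · have := (mem_VsetE_links (L.map turn) z d a).1 ⟨_, h, Sym2.mem_mk_left _ _⟩
      rw [mem_ends_map_turn] at this
      simp only [ends] at this
      grind

theorem pathEdges_map_range (f : ℕ → V) (n : ℕ) :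
    pathEdges ((List.range (n + 1)).map f) =
      (Finset.range n).image fun i => s(f i, f (i + 1)) := by
  induction n with
  | zero => simp [pathEdges]
  | succ n ih =>
    have h := pathEdges_append ((List.range n).map f) [] (f n) (f (n + 1))
    rw [List.range_succ, List.map_append] at ih
    rw [List.range_succ, List.range_succ, Finset.range_add_one, Finset.image_insert, ← ih]
    simp only [List.map_append, List.append_assoc, List.map_cons, List.map_nil, List.cons_append,
      List.nil_append] at h ⊢
    rw [h]
    simp [pathEdges]

theorem IsPathE.exists_list {F : Finset (Sym2 V)} {a b : V} (h : IsPathE F a b) :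
    ∃ m : List V, (a :: (m ++ [b])).Nodup ∧ F = pathEdges (a :: (m ++ [b])) := by
  obtain ⟨n, hn, f, hf, rfl, rfl, rfl⟩ := h
  obtain ⟨k, rfl⟩ : ∃ k, n = k + 1 := ⟨n - 1, by omega⟩
  have h : f 0 :: ((List.range k).map (fun i => f (i + 1)) ++ [f (k + 1)]) =
      (List.range (k + 1 + 1)).map f := by
    rw [List.range_succ_eq_map, List.range_succ]
    simp [Function.comp_def]
  refine ⟨(List.range k).map (fun i => f (i + 1)), ?_, ?_⟩
  · rw [h]
    refine List.Nodup.map_on ?_ List.nodup_range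
    intro x hx y hy hxy
    simp only [List.mem_range] at hx hy
    exact hf x (by omega) y (by omega) hxy
  · rw [h, pathEdges_map_range]

theorem isPathE_pathEdges {a b : V} {m : List V} (h : (a :: (m ++ [b])).Nodup) :
    IsPathE (pathEdges (a :: (m ++ [b]))) a b := by
  set l := a :: (m ++ [b]) with hl
  have hlen : l.length = m.length + 1 + 1 := by simp [hl]
  refine ⟨m.length + 1, by omega, fun i => l.getD i a, ?_, ?_, ?_, ?_⟩
  · intro i hi j hj hij
    simp only at hij
    rw [List.getD_eq_getElem _ _ (by omega), List.getD_eq_getElem _ _ (by omega)] at hij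
    exact (h.getElem_inj_iff).1 hij
  · simp [hl]
  · simp [hl]
  · rw [← pathEdges_map_range]
    congr 1
    refine List.ext_getElem (by simp [hlen]) fun i h₁ h₂ => ?_
    simp [h₁]

theorem isCycleE_pathEdges {a : V} {l : List V} (h : (a :: l).Nodup) (hl : 2 ≤ l.length) :
    IsCycleE (pathEdges (a :: (l ++ [a]))) := by
  refine ⟨l.length + 1, by omega, fun i => (a :: l).getD i a, ?_, ?_⟩
  · intro i hi j hj hij
    simp only at hij
    rw [List.getD_eq_getElem _ _ (by simpa using hi),
      List.getD_eq_getElem _ _ (by simpa using hj)] at hij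
    exact (h.getElem_inj_iff).1 hij
  · have hmap : a :: (l ++ [a]) = (List.range (l.length + 1 + 1)).map
        fun i => (a :: l).getD (i % (l.length + 1)) a := by
      refine List.ext_getElem (by simp) fun i h₁ h₂ => ?_
      simp only [List.length_cons, List.length_append, List.length_nil] at h₁
      simp only [List.getElem_map, List.getElem_range]
      rcases Nat.lt_or_ge i (l.length + 1) with hi | hi
      · rw [Nat.mod_eq_of_lt hi, List.getD_eq_getElem _ _ (by simpa using hi)]
        simp only [← List.cons_append]
        rw [List.getElem_append_left]
      · obtain rfl : i = l.length + 1 := by omega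
        simp
    rw [hmap, pathEdges_map_range]
    refine Finset.image_congr fun i hi => ?_
    simp only [Finset.coe_range, Set.mem_Iio] at hi
    simp only [Nat.mod_eq_of_lt hi]

theorem isTourE_pathEdges {a : V} {l : List V} (h : (a :: l).Nodup) (hl : 2 ≤ l.length)
    (hV : ∀ v, v ∈ a :: l) : IsTourE (pathEdges (a :: (l ++ [a]))) := by
  refine ⟨isCycleE_pathEdges h hl, Set.eq_univ_of_forall fun v => ?_⟩
  obtain ⟨b, l', hb⟩ := List.exists_cons_of_ne_nil (l := l ++ [a]) (by simp)
  have := hV v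
  rw [hb, mem_VsetE_pathEdges, ← hb]
  simp only [List.mem_cons, List.mem_append] at this ⊢
  tauto

theorem degE_mono {F G : Finset (Sym2 V)} (h : F ⊆ G) (v : V) : degE F v ≤ degE G v :=
  Finset.card_le_card (Finset.filter_subset_filter _ h)

theorem two_le_degE {F : Finset (Sym2 V)} {v x y : V} (hx : s(v, x) ∈ F) (hy : s(v, y) ∈ F)
    (hxy : x ≠ y) : 2 ≤ degE F v := by
  rw [← Finset.card_pair (a := s(v, x)) (b := s(v, y)) (by rw [Ne, Sym2.eq_iff]; grind)]
  refine Finset.card_le_card ?_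
  intro e he
  simp only [Finset.mem_insert, Finset.mem_singleton] at he
  rcases he with rfl | rfl <;> simp [hx, hy]

theorem two_le_degE_interior {z w v : V} {m : List V} (h : (z :: (m ++ [w])).Nodup)
    (hv : v ∈ m) : 2 ≤ degE (pathEdges (z :: (m ++ [w]))) v := by
  obtain ⟨p, q, rfl⟩ := List.append_of_mem hv
  obtain ⟨p', x, hp⟩ := List.eq_nil_or_concat' (z :: p) |>.resolve_left (by simp)
  obtain ⟨y, q', hq⟩ := List.exists_cons_of_ne_nil (l := q ++ [w]) (by simp)
  have hl : z :: (p ++ v :: q ++ [w]) = p' ++ x :: v :: y :: q' := by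
    rw [← hq, List.append_assoc, ← List.cons_append, hp]
    simp
  rw [hl] at h ⊢
  rw [pathEdges_append]
  refine two_le_degE (x := x) (y := y) ?_ ?_ ?_
  · simp [Sym2.eq_swap (a := x)]
  · simp [pathEdges]
  · rintro rfl
    simp [List.nodup_append] at h

theorem degE_eq_zero {F : Finset (Sym2 V)} {v : V} : degE F v = 0 ↔ v ∉ VsetE F := by
  simp [degE, VsetE, Finset.filter_eq_empty_iff]

theorem degE_insert {F : Finset (Sym2 V)} {e : Sym2 V} {v : V} (he : e ∉ F) (hv : v ∈ e) :
    degE (insert e F) v = degE F v + 1 := by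
  rw [degE, Finset.filter_insert, if_pos hv, Finset.card_insert_of_notMem (by simp [he])]
  rfl

theorem degE_head {z b : V} {l : List V} (h : (z :: b :: l).Nodup) :
    degE (pathEdges (z :: b :: l)) z = 1 := by
  have hz : z ∉ VsetE (pathEdges (b :: l)) := fun ⟨e, he, hv⟩ =>
    (List.nodup_cons.1 h).1 (mem_of_mem_pathEdges he hv)
  rw [pathEdges, degE_insert (fun he => hz ⟨_, he, by simp⟩) (by simp), degE_eq_zero.2 hz]

theorem degE_fst {t : Segment V} (h : (verts t).Nodup) : degE (pathEdges (verts t)) t.1 = 1 := by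
  obtain ⟨z, m, w⟩ := t
  cases m <;> exact degE_head h

theorem mem_V1E_verts {t : Segment V} (h : (verts t).Nodup) (v : V) :
    v ∈ V1E (pathEdges (verts t)) ↔ v = t.1 ∨ v = t.2.2 := by
  constructor
  · intro hv
    have hv : degE (pathEdges (verts t)) v = 1 := hv
    have hmem : v ∈ verts t := by
      rw [← mem_VsetE_verts]
      by_contra hn
      rw [degE_eq_zero.2 hn] at hv
      omega
    have hint : v ∉ t.2.1 := fun hn => by
      have := two_le_degE_interior h hn
      change 2 ≤ degE (pathEdges (verts t)) v at this
      omega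
    simpa [verts, hint] using hmem
  · rintro (rfl | rfl)
    · exact degE_fst h
    · have := degE_fst (t := turn t) (by rwa [verts_turn, List.nodup_reverse])
      rwa [pathEdges_turn] at this

theorem mem_V1E_union {F G : Finset (Sym2 V)} (h : ∀ v ∈ VsetE F, v ∉ VsetE G) (v : V) :
    v ∈ V1E (F ∪ G) ↔ v ∈ V1E F ∨ v ∈ V1E G := by
  have hd : Disjoint F G := by
    rw [Finset.disjoint_left]
    intro e he hg
    induction e with
    | h x y => exact h x ⟨_, he, by simp⟩ ⟨_, hg, by simp⟩
  have hadd : degE (F ∪ G) v = degE F v + degE G v := by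
    rw [degE, Finset.filter_union, Finset.card_union_of_disjoint
      (Finset.disjoint_filter_filter hd)]
    rfl
  have hz : degE F v = 0 ∨ degE G v = 0 := by
    rw [degE_eq_zero, degE_eq_zero]
    by_cases hv : v ∈ VsetE F
    · exact Or.inr (h v hv)
    · exact Or.inl hv
  change degE _ v = 1 ↔ degE _ v = 1 ∨ degE _ v = 1
  omega

theorem mem_V1E_edges {L : List (Segment V)} (h : (allVerts L).Nodup) (v : V) :
    v ∈ V1E (edges L) ↔ v ∈ ends L := by
  induction L with
  | nil => simp [V1E, degE, edges, ends]
  | cons t L ih =>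
    simp only [allVerts, List.flatMap_cons, List.nodup_append'] at h
    rw [edges, mem_V1E_union, mem_V1E_verts h.1, ih h.2.1]
    · simp [ends, or_assoc]
    · intro u hu hu'
      rw [mem_VsetE_verts] at hu
      rw [mem_VsetE_edges] at hu'
      exact h.2.2 hu hu'

/-- A vertex of degree at most one can be taken as the last vertex of the first segment. -/
theorem exists_segment_ending {L : List (Segment V)} (h : (allVerts L).Nodup) {v : V}
    (hv : v ∈ VsetE (edges L)) (hdeg : degE (edges L) v ≤ 1) :
    ∃ (z : V) (m : List V) (L' : List (Segment V)),
      edges L = edges ((z, m, v) :: L') ∧ (allVerts L).Perm (allVerts ((z, m, v) :: L')) := by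
  have h1 : v ∈ ends L := by
    rw [← mem_V1E_edges h]
    have := mt degE_eq_zero.1 (not_not.2 hv)
    change degE _ v = 1
    omega
  obtain ⟨⟨z, m, w⟩, ht, htv⟩ := List.mem_flatMap.1 h1
  have hp := List.perm_cons_erase ht
  simp only [List.mem_cons, List.not_mem_nil, or_false] at htv
  rcases htv with rfl | rfl
  · refine ⟨w, m.reverse, L.erase (v, m, w), (edges_perm hp).trans ?_, (allVerts_perm hp).trans ?_⟩
    · rw [edges, edges, ← pathEdges_turn]
      rfl
    · simp only [allVerts, List.flatMap_cons]
      refine List.Perm.append_right _ ?_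
      exact (List.reverse_perm _).symm.trans (by rw [← verts_turn]; rfl)
  · exact ⟨z, m, _, edges_perm hp, allVerts_perm hp⟩

/-- An acyclic 2-matching is a disjoint union of paths. -/
theorem exists_segments (F : Finset (Sym2 V)) (hF : IsKMatching 2 F) (hA : AcyclicE F) :
    ∃ L : List (Segment V), (allVerts L).Nodup ∧ F = edges L := by
  induction F using Finset.induction_on with
  | empty => exact ⟨[], by simp [allVerts], rfl⟩
  | insert e F he ih =>
    have hsub := Finset.subset_insert e F
    obtain ⟨L, hL, rfl⟩ := ih
      ⟨fun e h => hF.1 e (hsub h), fun v => (degE_mono hsub v).trans (hF.2 v)⟩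
      (fun C hC => hA C (hC.trans hsub))
    obtain ⟨a, b, rfl⟩ : ∃ a b, e = s(a, b) := by
      induction e with
      | h a b => exact ⟨a, b, rfl⟩
    have hab : a ≠ b := by simpa using hF.1 _ (Finset.mem_insert_self _ _)
    have hda : degE (edges L) a ≤ 1 := by
      have := hF.2 a
      rw [degE_insert he (by simp)] at this
      omega
    have hdb : degE (edges L) b ≤ 1 := by
      have := hF.2 b
      rw [degE_insert he (by simp)] at this
      omega
    have hext : ∀ x y z : V, ∀ m : List V, ∀ L' : List (Segment V),
        edges ((z, m ++ [x], y) :: L') = insert s(x, y) (edges ((z, m, x) :: L')) := by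
      intro x y z m L'
      have := pathEdges_append (z :: m) [] x y
      simp only [List.cons_append] at this
      simp [edges, verts, this, pathEdges, Finset.union_comm]
    have key : ∀ x y : V, x ≠ y → degE (edges L) x ≤ 1 → x ∈ VsetE (edges L) →
        y ∉ VsetE (edges L) →
        ∃ L' : List (Segment V), (allVerts L').Nodup ∧ insert s(x, y) (edges L) = edges L' := by
      intro x y hxy hdx hx hy
      obtain ⟨z, m, L', hE, hV⟩ := exists_segment_ending hL hx hdx
      refine ⟨(z, m ++ [x], y) :: L', ?_, by rw [hext, hE]⟩
      rw [mem_VsetE_edges] at hy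
      have h1 : (y :: allVerts ((z, m, x) :: L')).Nodup :=
        List.nodup_cons.2 ⟨fun h => hy (hV.mem_iff.2 h), hV.nodup_iff.1 hL⟩
      refine (List.Perm.nodup_iff ?_).1 h1
      simp only [allVerts, List.flatMap_cons, verts]
      simp only [List.append_assoc, List.cons_append, List.nil_append]
      grind
    by_cases ha : a ∈ VsetE (edges L) <;> by_cases hb : b ∈ VsetE (edges L)
    · obtain ⟨z, m, L', hE, hV⟩ := exists_segment_ending hL ha hda
      rw [hE] at hA hb hdb hda he ⊢
      have hN := hV.nodup_iff.1 hL
      simp only [allVerts, List.flatMap_cons, List.nodup_append'] at hN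
      rw [edges, mem_VsetE_union, mem_VsetE_verts] at hb
      rcases hb with hb | hb
      · exfalso
        have hbz : b = z := by
          have hint : b ∉ m := fun hn => by
            have h2 := two_le_degE_interior hN.1 hn
            have h3 := degE_mono (F := pathEdges (verts (z, m, a)))
              (G := edges ((z, m, a) :: L')) (by simp [edges]) b
            change 2 ≤ degE (pathEdges (verts (z, m, a))) b at h2
            omega
          simpa [verts, hint, hab.symm] using hb
        subst hbz
        cases m with
        | nil =>
          apply he
          simp [edges, verts, pathEdges, Sym2.eq_swap (a := a)]
        | cons c m =>
          refine hA _ ?_ (isCycleE_pathEdges hN.1 (by simp))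
          have := pathEdges_append (b :: c :: m) [] a b
          simp only [List.cons_append, List.append_assoc, List.nil_append] at this ⊢
          rw [this]
          simp only [edges, verts, pathEdges, List.cons_append]
          intro e
          simp only [Finset.mem_insert, Finset.mem_union, Finset.notMem_empty]
          tauto
      · have hLb : degE (edges L') b ≤ 1 := (degE_mono (by simp [edges]) b).trans hdb
        obtain ⟨y, q, L'', hE', hV'⟩ := exists_segment_ending hN.2.1 hb hLb
        refine ⟨(z, m ++ a :: b :: q.reverse, y) :: L'', ?_, ?_⟩
        · have h1 := hV.nodup_iff.1 hL
          refine (List.Perm.nodup_iff ?_).1 h1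
          simp only [allVerts, List.flatMap_cons, verts] at hV' ⊢
          refine (hV'.append_left _).trans ?_
          have := q.reverse_perm
          grind
        · have h1 := pathEdges_append (z :: m) (q.reverse ++ [y]) a b
          have h2 := pathEdges_turn (y, q, b)
          simp only [verts, turn, List.cons_append] at h1 h2
          simp only [edges, hE', verts, List.cons_append, List.append_assoc]
          rw [h1, h2]
          grind
    · exact key a b hab hda ha hb
    · rw [Sym2.eq_swap]
      exact key b a hab.symm hdb hb ha
    · rw [mem_VsetE_edges] at ha hb
      refine ⟨(a, [], b) :: L, ?_, ?_⟩
      · simp only [allVerts, List.flatMap_cons, verts] at ha hb hL ⊢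
        simp [hab, ha, hb, hL]
      · simp [edges, verts, pathEdges]

theorem IsPathE.reverse {F : Finset (Sym2 V)} {a b : V} (h : IsPathE F a b) : IsPathE F b a := by
  obtain ⟨m, hm, rfl⟩ := h.exists_list
  have hr : (a :: (m ++ [b])).reverse = b :: (m.reverse ++ [a]) := by simp
  rw [← pathEdges_reverse, hr]
  exact isPathE_pathEdges (by rwa [← hr, List.nodup_reverse])

theorem links_concat (L : List (Segment V)) (t : Segment V) (a c : V) :
    links (L ++ [t]) a c = insert s(t.2.2, c) (links L a t.1) := by
  induction L generalizing a with
  | nil => simp [links, Finset.pair_comm]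
  | cons u L ih => simp [links, ih, Finset.insert_comm]

/-- Linking all segments of a path cover cyclically, in any order and orientation, produces a tour,
and the links join exactly the endpoints of the segments. -/
theorem tour_of_links {L L' : List (Segment V)} {a c : V} {n : List V}
    (hE : edges L' = edges L) (hL : (allVerts L').Perm (allVerts L))
    (hN : (allVerts ((c, n, a) :: L)).Nodup) (hV : ∀ v, v ∈ allVerts ((c, n, a) :: L))
    (hn : n ≠ []) :
    IsTourE (edges ((c, n, a) :: L) ∪ links L' a c) ∧
      VsetE (links L' a c) = V1E (edges ((c, n, a) :: L)) := by
  have hE' : edges ((c, n, a) :: L) = edges ((c, n, a) :: L') := by rw [edges, edges, hE]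
  have hL' : (allVerts ((c, n, a) :: L')).Perm (allVerts ((c, n, a) :: L)) := by
    simp only [allVerts, List.flatMap_cons] at hL ⊢
    exact hL.append_left _
  have hp : (allVerts ((c, n, a) :: L')).Perm (a :: (allVerts L' ++ c :: n)) := by
    simp only [allVerts, List.flatMap_cons, verts]
    grind
  rw [← hL'.nodup_iff] at hN
  rw [hE']
  constructor
  · have h := isTourE_pathEdges (hp.nodup_iff.1 hN) ?_
      fun v => hp.mem_iff.1 (hL'.mem_iff.2 (hV v))
    · rw [List.append_assoc, List.cons_append, pathEdges_links] at h
      convert h using 1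
      simp only [edges, verts]
      ext e
      simp only [Finset.mem_union]
      tauto
    · have := List.length_pos_iff.2 hn
      simp only [List.length_append, List.length_cons]
      omega
  · ext v
    rw [mem_V1E_edges hN, mem_VsetE_links]
    simp only [ends, List.flatMap_cons, List.cons_append, List.nil_append, List.mem_cons]
    tauto

theorem exists_links_path {L : List (Segment V)} {a b c : V}
    (hN : (a :: b :: c :: ends L).Nodup) :
    IsPathE (links L a c ∪ links (L.map turn) b c) a b := by
  obtain ⟨p, q, hpq, h⟩ := exists_links_union L a b c c [] []
  have hE : links L a c ∪ links (L.map turn) b c =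
      pathEdges (a :: (p ++ [c])) ∪ pathEdges (b :: (q ++ [c])) := by
    simpa [pathEdges] using h
  have hr : pathEdges (b :: (q ++ [c])) = pathEdges (c :: (q.reverse ++ [b])) := by
    rw [← pathEdges_reverse]
    simp
  have happ : ∀ x y l, pathEdges (a :: (p ++ x :: y :: l)) =
      pathEdges (a :: (p ++ [x])) ∪ pathEdges (x :: y :: l) :=
    fun x y l => pathEdges_append (a :: p) l x y
  obtain ⟨y, l, hy⟩ := List.exists_cons_of_ne_nil (l := q.reverse ++ [b]) (by simp)
  rw [hE, hr, hy, ← happ, ← hy]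
  have := isPathE_pathEdges (a := a) (b := b) (m := p ++ c :: q.reverse) ?_
  · simpa using this
  · refine (List.Perm.nodup_iff ?_).1 hN
    have := q.reverse_perm
    grind

theorem exists_links_paths {L : List (Segment V)} {a b c d e : V} {r k : List V}
    (hr : c :: r = k ++ [e]) (hN : (a :: b :: d :: (c :: r ++ ends L)).Nodup) :
    (∃ R1 R2 : Finset (Sym2 V), IsPathE R1 e b ∧ IsPathE R2 a d ∧
        Disjoint (VsetE R1) (VsetE R2) ∧
        (links L a c ∪ pathEdges (c :: r)) ∪ links (L.map turn) b d = R1 ∪ R2) ∨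
      (∃ R1 R2 : Finset (Sym2 V), IsPathE R1 e a ∧ IsPathE R2 b d ∧
        Disjoint (VsetE R1) (VsetE R2) ∧
        (links L a c ∪ pathEdges (c :: r)) ∪ links (L.map turn) b d = R1 ∪ R2) := by
  obtain ⟨p, q, hpq, h⟩ := exists_links_union L a b c d r []
  have hp₁ : (a :: b :: d :: (c :: r ++ ends L)).Perm
      ((a :: (p ++ c :: r)) ++ (b :: (q ++ [d]))) := by
    clear h hN hr
    grind
  have hp₂ : (a :: b :: d :: (c :: r ++ ends L)).Perm
      ((b :: (q ++ c :: r)) ++ (a :: (p ++ [d]))) := by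
    clear h hN hr
    grind
  have key : ∀ x y : V, ∀ p q : List V, ((x :: (p ++ c :: r)) ++ (y :: (q ++ [d]))).Nodup →
      IsPathE (pathEdges (x :: (p ++ c :: r))) e x ∧ IsPathE (pathEdges (y :: (q ++ [d]))) y d ∧
      Disjoint (VsetE (pathEdges (x :: (p ++ c :: r)))) (VsetE (pathEdges (y :: (q ++ [d])))) := by
    intro x y p q hN
    rw [List.nodup_append'] at hN
    refine ⟨?_, isPathE_pathEdges hN.2.1, ?_⟩
    · have h1 := hN.1
      rw [hr, ← List.append_assoc] at h1 ⊢
      exact (isPathE_pathEdges h1).reverse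
    · rw [Set.disjoint_left]
      rintro v ⟨f, hf, hv⟩ ⟨g, hg, hv'⟩
      exact hN.2.2 (mem_of_mem_pathEdges hf hv) (mem_of_mem_pathEdges hg hv')
  have hd : pathEdges [d] = ∅ := rfl
  rw [hd, Finset.union_empty] at h
  rcases h with h | h
  · right
    obtain ⟨h1, h2, h3⟩ := key a b p q (hp₁.nodup_iff.1 hN)
    exact ⟨_, _, h1, h2, h3, h⟩
  · left
    obtain ⟨h1, h2, h3⟩ := key b a q p (hp₂.nodup_iff.1 hN)
    exact ⟨_, _, h1, h2, h3, h.trans (Finset.union_comm _ _)⟩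

/-- A maximal path shares no vertex with the edges outside of it. -/
theorem MaxPathE.notMem_VsetE_sdiff {F P G : Finset (Sym2 V)} (h : MaxPathE F P)
    (hG : G ⊆ F \ P) {v : V} (hv : v ∈ VsetE P) : v ∉ VsetE G := by
  rintro ⟨e, he, hve⟩
  have := Finset.mem_sdiff.1 (hG he)
  exact this.2 (h.2.2 e this.1 ⟨v, hve, hv⟩)

/-- The decomposition of the two path covers into common segments. -/
theorem exists_common_segments {T1 T2 O1 : Finset (Sym2 V)} {v0 v1 v2 v3 v4 z1 w1 : V}
    (hT1 : IsPathCoverE T1)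
    (hdist : v1 ≠ v2 ∧ v1 ≠ v3 ∧ v1 ≠ v4 ∧ v2 ≠ v3 ∧ v2 ≠ v4 ∧ v3 ≠ v4)
    (hd1 : T1 \ T2 = {s(v3, v4)}) (hd2 : T2 \ T1 = {s(v0, v1)})
    (hmid : MaxPathE (T1 ∩ T2) ({s(v1, v2), s(v2, v3)} : Finset (Sym2 V)))
    (hO1 : MaxPathE T1 O1) (hO2 : MaxPathE T2 O1) (hO : IsPathE O1 z1 w1) :
    ∃ (m : List V) (L : List (Segment V)),
      T1 ∩ T2 = edges ((v1, [v2], v3) :: (z1, m, w1) :: L) ∧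
      (allVerts ((v1, [v2], v3) :: (z1, m, w1) :: L)).Nodup ∧
      v0 ∉ verts (z1, m, w1) ∧ v4 ∉ verts (z1, m, w1) := by
  have e1 : s(v3, v4) ∈ T1 ∧ s(v3, v4) ∉ T2 := by
    rw [← Finset.mem_sdiff, hd1]
    simp
  have e2 : s(v0, v1) ∈ T2 ∧ s(v0, v1) ∉ T1 := by
    rw [← Finset.mem_sdiff, hd2]
    simp
  have hP : ({s(v1, v2), s(v2, v3)} : Finset (Sym2 V)) =
      pathEdges (verts (v1, [v2], v3)) := by simp [verts, pathEdges]
  have n3 : v3 ∉ VsetE O1 := fun h => e1.2 (hO2.1 (hO1.2.2 _ e1.1 ⟨v3, by simp, h⟩))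
  have n4 : v4 ∉ VsetE O1 := fun h => e1.2 (hO2.1 (hO1.2.2 _ e1.1 ⟨v4, by simp, h⟩))
  have n1 : v1 ∉ VsetE O1 := fun h => e2.2 (hO1.1 (hO2.2.2 _ e2.1 ⟨v1, by simp, h⟩))
  have n0 : v0 ∉ VsetE O1 := fun h => e2.2 (hO1.1 (hO2.2.2 _ e2.1 ⟨v0, by simp, h⟩))
  have n2 : v2 ∉ VsetE O1 := fun h => by
    have h23 : s(v2, v3) ∈ T1 := (Finset.mem_inter.1 (hmid.1 (by simp))).1
    exact n3 ⟨_, hO1.2.2 _ h23 ⟨v2, by simp, h⟩, by simp⟩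
  rw [hP] at hmid
  obtain ⟨m, hm, hOm⟩ := hO.exists_list
  change (verts (z1, m, w1)).Nodup at hm
  change O1 = pathEdges (verts (z1, m, w1)) at hOm
  set F := ((T1 ∩ T2) \ pathEdges (verts (v1, [v2], v3))) \ O1 with hF
  have hFT : F ⊆ T1 :=
    (Finset.sdiff_subset.trans Finset.sdiff_subset).trans Finset.inter_subset_left
  obtain ⟨L, hL, hFL⟩ := exists_segments F
    ⟨fun e he => hT1.1.1 e (hFT he), fun v => (degE_mono hFT v).trans (hT1.1.2 v)⟩
    fun C hC => hT1.2.2 C (hC.trans hFT)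
  refine ⟨m, L, ?_, ?_, ?_, ?_⟩
  · rw [edges, edges, ← hFL, ← hOm, hF]
    have hs : O1 ⊆ T1 ∩ T2 := Finset.subset_inter hO1.1 hO2.1
    have hs' := hmid.1
    grind
  · have hd₁ : ∀ v ∈ verts (v1, [v2], v3), v ∉ allVerts L := by
      intro v hv
      rw [← mem_VsetE_verts] at hv
      rw [← mem_VsetE_edges, ← hFL]
      exact hmid.notMem_VsetE_sdiff Finset.sdiff_subset hv
    have hd₂ : ∀ v ∈ verts (z1, m, w1), v ∉ allVerts L := by
      intro v hv
      rw [← mem_VsetE_verts, ← hOm] at hv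
      rw [← mem_VsetE_edges, ← hFL]
      refine hO1.notMem_VsetE_sdiff ?_ hv
      exact Finset.sdiff_subset_sdiff (Finset.sdiff_subset.trans Finset.inter_subset_left) subset_rfl
    have hd₃ : ∀ v ∈ verts (v1, [v2], v3), v ∉ verts (z1, m, w1) := by
      intro v hv
      rw [← mem_VsetE_verts, ← hOm]
      simp only [verts, List.cons_append, List.nil_append, List.mem_cons, List.not_mem_nil,
        or_false] at hv
      rcases hv with rfl | rfl | rfl <;> assumption
    have hd₄ : (verts (v1, [v2], v3)).Nodup := by
      simp [verts]
      tauto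
    simp only [allVerts, List.flatMap_cons, List.nodup_append'] at hL hd₁ hd₂ ⊢
    refine ⟨hd₄, ⟨hm, hL, fun v h h' => hd₂ v h h'⟩, fun v h h' => ?_⟩
    rcases List.mem_append.1 h' with h' | h'
    · exact hd₃ v h h'
    · exact hd₁ v h h'
  · rwa [← mem_VsetE_verts, ← hOm]
  · rwa [← mem_VsetE_verts, ← hOm]

/-- `B1` and `B2` are disjoint, complete the path covers `T1` and `T2` to tours by joining up their
endpoints, and contain `{a, z}` and `{b, w}` respectively. -/
def CompletesToTours (T1 T2 B1 B2 : Finset (Sym2 V)) (a z b w : V) : Prop :=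
  B1 ∩ B2 = ∅ ∧ IsTourE (T1 ∪ B1) ∧ IsTourE (T2 ∪ B2) ∧
    VsetE B1 = V1E T1 ∧ VsetE B2 = V1E T2 ∧ s(a, z) ∈ B1 ∧ s(b, w) ∈ B2

theorem exists_completion_of_common_end {z w a b c : V} {m n₁ n₂ : List V}
    {L : List (Segment V)} (hN₁ : (allVerts ((c, n₁, a) :: (z, m, w) :: L)).Nodup)
    (hN₂ : (allVerts ((c, n₂, b) :: (z, m, w) :: L)).Nodup)
    (hV₁ : ∀ v, v ∈ allVerts ((c, n₁, a) :: (z, m, w) :: L))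
    (hV₂ : ∀ v, v ∈ allVerts ((c, n₂, b) :: (z, m, w) :: L))
    (hn₁ : n₁ ≠ []) (hn₂ : n₂ ≠ []) (hab : a ≠ b) :
    ∃ B1 B2 : Finset (Sym2 V),
      CompletesToTours (edges ((c, n₁, a) :: (z, m, w) :: L))
        (edges ((c, n₂, b) :: (z, m, w) :: L)) B1 B2 a z b w ∧ IsPathE (B1 ∪ B2) a b := by
  have h1 := tour_of_links rfl (List.Perm.refl _) hN₁ hV₁ hn₁
  have h2 := tour_of_links (edges_map_turn _) (allVerts_map_turn _) hN₂ hV₂ hn₂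
  set K := (z, m, w) :: L with hK
  have hk₁ : (c :: a :: ends K).Nodup := (ends_subperm _).nodup hN₁
  have hk₂ : (c :: b :: ends K).Nodup := (ends_subperm _).nodup hN₂
  simp only [List.nodup_cons, List.mem_cons, not_or] at hk₁ hk₂
  have ⟨⟨hca, hc⟩, ha, hKe⟩ := hk₁
  have ⟨⟨hcb, _⟩, hb, _⟩ := hk₂
  refine ⟨links K a c, links (K.map turn) b c,
    ⟨?_, h1.1, h2.1, h1.2, h2.2, by simp [hK, links], by simp [hK, links, turn]⟩, ?_⟩
  · rw [← Finset.disjoint_iff_inter_eq_empty]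
    exact disjoint_links K a b c c hab ha hb hKe hc hc (Ne.symm hca) (Ne.symm hcb)
  · apply exists_links_path
    simp only [List.nodup_cons, List.mem_cons]
    grind

/-- `B` consists of two disjoint paths pairing `e` with one of `a`, `b` and `d` with the other. -/
def IsPathPair (B : Finset (Sym2 V)) (a b d e : V) : Prop :=
  (∃ R1 R2 : Finset (Sym2 V), IsPathE R1 e b ∧ IsPathE R2 a d ∧
      Disjoint (VsetE R1) (VsetE R2) ∧ B = R1 ∪ R2) ∨
    (∃ R1 R2 : Finset (Sym2 V), IsPathE R1 e a ∧ IsPathE R2 b d ∧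
      Disjoint (VsetE R1) (VsetE R2) ∧ B = R1 ∪ R2)

theorem exists_completion_of_swapped_end {z w a b d e : V} {m n₁ n₂ : List V}
    {L : List (Segment V)} (hN₁ : (allVerts ((e, n₁, a) :: (z, m, w) :: L)).Nodup)
    (hN₂ : (allVerts ((d, n₂, b) :: (z, m, w) :: L)).Nodup)
    (hV₁ : ∀ v, v ∈ allVerts ((e, n₁, a) :: (z, m, w) :: L))
    (hV₂ : ∀ v, v ∈ allVerts ((d, n₂, b) :: (z, m, w) :: L))
    (hn₁ : n₁ ≠ []) (hn₂ : n₂ ≠ []) (hab : a ≠ b) (had : a ≠ d) (hbe : b ≠ e) (hde : d ≠ e) :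
    ∃ B1 B2 : Finset (Sym2 V),
      CompletesToTours (edges ((e, n₁, a) :: (z, m, w) :: L))
        (edges ((d, n₂, b) :: (z, m, w) :: L)) B1 B2 a z b w ∧ IsPathPair (B1 ∪ B2) a b d e := by
  have h1 := tour_of_links rfl (List.Perm.refl _) hN₁ hV₁ hn₁
  have h2 := tour_of_links (edges_map_turn _) (allVerts_map_turn _) hN₂ hV₂ hn₂
  set K := (z, m, w) :: L with hK
  have hk₁ : (e :: a :: ends K).Nodup := (ends_subperm _).nodup hN₁
  have hk₂ : (d :: b :: ends K).Nodup := (ends_subperm _).nodup hN₂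
  simp only [List.nodup_cons, List.mem_cons, not_or] at hk₁ hk₂
  have ⟨⟨hea, he⟩, ha, hKe⟩ := hk₁
  have ⟨⟨hdb, hd⟩, hb, _⟩ := hk₂
  refine ⟨links K a e, links (K.map turn) b d,
    ⟨?_, h1.1, h2.1, h1.2, h2.2, by simp [hK, links], by simp [hK, links, turn]⟩, ?_⟩
  · rw [← Finset.disjoint_iff_inter_eq_empty]
    exact disjoint_links K a b e d hab ha hb hKe he hd had hbe
  · have := exists_links_paths (L := K) (a := a) (b := b) (c := e) (d := d) (e := e) (r := [])
      (k := []) rfl ?_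
    · simpa [pathEdges, IsPathPair] using this
    · simp only [List.nodup_cons, List.mem_cons, List.cons_append, List.nil_append]
      grind

theorem exists_completion_of_two_segments {z w a b d e x y : V} {m n₁ n₂ p q : List V}
    {L : List (Segment V)}
    (hN₁ : (allVerts ((y, n₁, a) :: (x, p, e) :: (z, m, w) :: L)).Nodup)
    (hN₂ : (allVerts ((x, n₂, b) :: (y, q, d) :: (z, m, w) :: L)).Nodup)
    (hV₁ : ∀ v, v ∈ allVerts ((y, n₁, a) :: (x, p, e) :: (z, m, w) :: L))
    (hV₂ : ∀ v, v ∈ allVerts ((x, n₂, b) :: (y, q, d) :: (z, m, w) :: L))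
    (hn₁ : n₁ ≠ []) (hn₂ : n₂ ≠ []) (hab : a ≠ b) (had : a ≠ d) (hbe : b ≠ e) (hde : d ≠ e) :
    ∃ B1 B2 : Finset (Sym2 V),
      CompletesToTours (edges ((y, n₁, a) :: (x, p, e) :: (z, m, w) :: L))
        (edges ((x, n₂, b) :: (y, q, d) :: (z, m, w) :: L)) B1 B2 a z b w ∧
      IsPathPair (B1 ∪ B2) a b d e := by
  have h1 := tour_of_links (edges_perm (List.perm_append_singleton _ _))
    (allVerts_perm (List.perm_append_singleton _ _)) hN₁ hV₁ hn₁
  have hE : ∀ K : List (Segment V),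
      edges (K.map turn ++ [turn (y, q, d)]) = edges ((y, q, d) :: K) := by
    intro K
    rw [← edges_map_turn (_ :: K)]
    exact edges_perm (List.perm_append_singleton _ _)
  have hp : ∀ K : List (Segment V), (allVerts (K.map turn ++ [turn (y, q, d)])).Perm
      (allVerts ((y, q, d) :: K)) := by
    intro K
    exact (allVerts_perm (List.perm_append_singleton _ _)).trans (allVerts_map_turn (_ :: K))
  have h2 := tour_of_links (hE _) (hp _) hN₂ hV₂ hn₂
  rw [links_concat] at h1 h2
  simp only [turn] at h2
  change _ ∧ _ at h2
  set K := (z, m, w) :: L with hK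
  have hk₁ : (y :: a :: x :: e :: ends K).Nodup := (ends_subperm _).nodup hN₁
  have hk₂ : (x :: b :: y :: d :: ends K).Nodup := (ends_subperm _).nodup hN₂
  simp only [List.nodup_cons, List.mem_cons, not_or] at hk₁ hk₂
  have ⟨⟨_, _, _, hy⟩, ⟨_, _, ha⟩, ⟨_, hx⟩, he, hKe⟩ := hk₁
  have ⟨_, ⟨_, _, hb⟩, _, hd, _⟩ := hk₂
  refine ⟨insert s(e, y) (links K a x), insert s(y, x) (links (K.map turn) b d),
    ⟨?_, h1.1, h2.1, h1.2, h2.2, by simp [hK, links], by simp [hK, links, turn]⟩, ?_⟩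
  · rw [← Finset.disjoint_iff_inter_eq_empty, Finset.disjoint_insert_left,
      Finset.disjoint_insert_right, Finset.mem_insert, not_or]
    refine ⟨⟨?_, fun h => ?_⟩, fun h => ?_, ?_⟩
    · rw [Sym2.eq_iff]
      grind
    · have := (mem_VsetE_links (K.map turn) b d e).1 ⟨_, h, Sym2.mem_mk_left _ _⟩
      rw [mem_ends_map_turn] at this
      grind
    · have := (mem_VsetE_links K a x y).1 ⟨_, h, Sym2.mem_mk_left _ _⟩
      grind
    · exact disjoint_links K a b x d hab ha hb hKe hx hd had (by grind)
  · have h := exists_links_paths (L := K) (a := a) (b := b) (c := x) (d := d) (e := e)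
      (r := [y, e]) (k := [x, y]) rfl ?_
    · have hB : insert s(e, y) (links K a x) ∪ insert s(y, x) (links (K.map turn) b d) =
          (links K a x ∪ pathEdges [x, y, e]) ∪ links (K.map turn) b d := by
        simp only [pathEdges, Sym2.eq_swap (a := e), Sym2.eq_swap (a := y) (b := x)]
        ext f
        simp only [Finset.mem_union, Finset.mem_insert, Finset.notMem_empty]
        tauto
      rw [hB]
      exact h
    · simp only [List.nodup_cons, List.mem_cons, List.cons_append, List.nil_append]
      grind

theorem edges_extend (x u a b c : V) (q : List V) (L : List (Segment V)) :
    edges ((x, q ++ [u, a, b], c) :: L) = insert s(u, a) (edges ((a, [b], c) :: (x, q, u) :: L)) := by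
  have h := pathEdges_append (x :: q) [b, c] u a
  simp only [edges, verts, List.append_assoc, List.cons_append, List.nil_append] at h ⊢
  rw [h]
  ext e
  simp only [Finset.mem_union, Finset.mem_insert]
  tauto

theorem edges_cons_turn (t : Segment V) (L : List (Segment V)) :
    edges (turn t :: L) = edges (t :: L) := by
  rw [edges, edges, pathEdges_turn]

theorem eq_insert_inter {S T : Finset (Sym2 V)} {e : Sym2 V} (h : S \ T = {e}) :
    S = insert e (S ∩ T) := by
  rw [Finset.insert_eq, ← h, Finset.sdiff_union_inter]

/-- Lemma 12 of the paper. -/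
theorem stmt11 (T1 T2 O1 : Finset (Sym2 V)) (v0 v1 v2 v3 v4 z1 w1 : V)
    (hT1 : IsPathCoverE T1) (hT2 : IsPathCoverE T2)
    (hdist : v1 ≠ v2 ∧ v1 ≠ v3 ∧ v1 ≠ v4 ∧ v2 ≠ v3 ∧ v2 ≠ v4 ∧ v3 ≠ v4)
    (hv0 : v0 ≠ v1 ∧ v0 ≠ v2 ∧ v0 ≠ v3)
    (hd1 : T1 \ T2 = {s(v3, v4)}) (hd2 : T2 \ T1 = {s(v0, v1)})
    (hmid : MaxPathE (T1 ∩ T2) ({s(v1, v2), s(v2, v3)} : Finset (Sym2 V)))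
    (hO1 : MaxPathE T1 O1) (hO2 : MaxPathE T2 O1) (hO : IsPathE O1 z1 w1) :
    ∃ B1 B2 : Finset (Sym2 V),
      B1 ∩ B2 = ∅ ∧
      IsTourE (T1 ∪ B1) ∧ IsTourE (T2 ∪ B2) ∧
      VsetE B1 = V1E T1 ∧ VsetE B2 = V1E T2 ∧
      s(v1, z1) ∈ B1 ∧ s(v3, w1) ∈ B2 ∧
      (v0 = v4 → IsPathE (B1 ∪ B2) v1 v3) ∧
      (v0 ≠ v4 →
        ((∃ R1 R2 : Finset (Sym2 V), IsPathE R1 v0 v3 ∧ IsPathE R2 v1 v4 ∧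
            Disjoint (VsetE R1) (VsetE R2) ∧ B1 ∪ B2 = R1 ∪ R2) ∨
         (∃ R1 R2 : Finset (Sym2 V), IsPathE R1 v0 v1 ∧ IsPathE R2 v3 v4 ∧
            Disjoint (VsetE R1) (VsetE R2) ∧ B1 ∪ B2 = R1 ∪ R2))) := by
  obtain ⟨m, L, hT, hN, h0O, h4O⟩ := exists_common_segments hT1 hdist hd1 hd2 hmid hO1 hO2 hO
  have hT1' := eq_insert_inter hd1
  have hT2' := eq_insert_inter hd2
  rw [Finset.inter_comm] at hT2'
  have e1 : s(v3, v4) ∉ T1 ∩ T2 := fun h => by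
    have h' : s(v3, v4) ∈ T1 \ T2 := by simp [hd1]
    exact (Finset.mem_sdiff.1 h').2 (Finset.mem_inter.1 h).2
  have e2 : s(v0, v1) ∉ T1 ∩ T2 := fun h => by
    have h' : s(v0, v1) ∈ T2 \ T1 := by simp [hd2]
    exact (Finset.mem_sdiff.1 h').2 (Finset.mem_inter.1 h).1
  rw [hT] at hT1' hT2' e1 e2
  obtain ⟨h12, h13, h14, h23, h24, h34⟩ := hdist
  obtain ⟨h01, h02, h03⟩ := hv0
  have hcov : ∀ S : Finset (Sym2 V), IsPathCoverE S → ∀ x y : V,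
      S = insert s(x, y) (edges ((v1, [v2], v3) :: (z1, m, w1) :: L)) →
      ∀ v, v = x ∨ v = y ∨ v ∈ allVerts ((v1, [v2], v3) :: (z1, m, w1) :: L) := by
    intro S hS x y hxy v
    have hv : v ∈ VsetE S := hS.2.1 ▸ Set.mem_univ v
    rwa [hxy, mem_VsetE_insert, mem_VsetE_edges] at hv
  have hcov4 : ∀ v, v = v4 ∨ v ∈ allVerts ((v1, [v2], v3) :: (z1, m, w1) :: L) := fun v => by
    rcases hcov T1 hT1 _ _ hT1' v with rfl | h | h
    · exact Or.inr (by simp [allVerts, verts])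
    · exact Or.inl h
    · exact Or.inr h
  have hcov0 : ∀ v, v = v0 ∨ v ∈ allVerts ((v1, [v2], v3) :: (z1, m, w1) :: L) := fun v => by
    rcases hcov T2 hT2 _ _ hT2' v with h | rfl | h
    · exact Or.inl h
    · exact Or.inr (by simp [allVerts, verts])
    · exact Or.inr h
  have hLsub : edges L ⊆ edges ((v1, [v2], v3) :: (z1, m, w1) :: L) := fun e he => by
    simp [edges, he]
  have hdeg : ∀ S : Finset (Sym2 V), IsPathCoverE S → ∀ f : Sym2 V, ∀ v ∈ f,
      f ∉ edges ((v1, [v2], v3) :: (z1, m, w1) :: L) →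
      S = insert f (edges ((v1, [v2], v3) :: (z1, m, w1) :: L)) → degE (edges L) v ≤ 1 := by
    intro S hS f v hv hf hSf
    have h1 := hS.1.2 v
    rw [hSf, degE_insert hf hv] at h1
    have := degE_mono hLsub v
    omega
  have hdeg4 := hdeg T1 hT1 _ v4 (by simp) e1 hT1'
  have hdeg0 := hdeg T2 hT2 _ v0 (by simp) e2 hT2'
  have hLN : (allVerts L).Nodup := (List.nodup_append'.1 (List.nodup_append'.1 hN).2.1).2.1
  have hmem : ∀ v, v ∈ allVerts ((v1, [v2], v3) :: (z1, m, w1) :: L) → v ≠ v1 → v ≠ v2 → v ≠ v3 →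
      v ∉ verts (z1, m, w1) → v ∈ VsetE (edges L) := by
    intro v hv n1 n2 n3 hO
    rw [mem_VsetE_edges]
    simp only [allVerts, List.flatMap_cons, List.mem_append, hO, false_or] at hv ⊢
    simpa [verts, n1, n2, n3] using hv
  by_cases h04 : v0 = v4
  · subst h04
    suffices h : ∃ B1 B2, CompletesToTours T1 T2 B1 B2 v1 z1 v3 w1 ∧ IsPathE (B1 ∪ B2) v1 v3 by
      obtain ⟨B1, B2, ⟨a1, a2, a3, a4, a5, a6, a7⟩, hP⟩ := h
      exact ⟨B1, B2, a1, a2, a3, a4, a5, a6, a7, fun _ => hP, fun h => absurd rfl h⟩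
    by_cases h4 : v0 ∈ VsetE (edges L)
    · obtain ⟨x, q, L', hE, hp⟩ := exists_segment_ending hLN h4 hdeg4
      have hV : ∀ v, v ∈ allVerts ((v1, [v2], v3) :: (z1, m, w1) :: L) := fun v => by
        rcases hcov4 v with rfl | h
        · rw [mem_VsetE_edges] at h4
          simp only [allVerts, List.flatMap_cons, List.mem_append] at h4 ⊢
          exact Or.inr (Or.inr h4)
        · exact h
      have hp₁ : (allVerts ((v1, [v2], v3) :: (z1, m, w1) :: L)).Perm
          (allVerts ((x, q ++ [v0, v3, v2], v1) :: (z1, m, w1) :: L')) := by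
        simp only [allVerts, List.flatMap_cons, verts] at hp ⊢
        clear * - hp
        grind
      have hp₂ : (allVerts ((v1, [v2], v3) :: (z1, m, w1) :: L)).Perm
          (allVerts ((x, q ++ [v0, v1, v2], v3) :: (z1, m, w1) :: L')) := by
        simp only [allVerts, List.flatMap_cons, verts] at hp ⊢
        clear * - hp
        grind
      have hE' : edges ((v1, [v2], v3) :: (z1, m, w1) :: L) =
          edges ((v1, [v2], v3) :: (x, q, v0) :: (z1, m, w1) :: L') := by
        simp only [edges] at hE ⊢
        rw [hE, Finset.union_left_comm (pathEdges (verts (z1, m, w1)))]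
      have hF₁ : T1 = edges ((x, q ++ [v0, v3, v2], v1) :: (z1, m, w1) :: L') := by
        rw [edges_extend, ← edges_cons_turn, Sym2.eq_swap]
        exact hT1'.trans (congrArg _ hE')
      have hF₂ : T2 = edges ((x, q ++ [v0, v1, v2], v3) :: (z1, m, w1) :: L') := by
        rw [edges_extend, hT2', hE']
      rw [hF₁, hF₂]
      exact exists_completion_of_common_end (hp₁.nodup_iff.1 hN) (hp₂.nodup_iff.1 hN)
        (fun v => hp₁.mem_iff.1 (hV v)) (fun v => hp₂.mem_iff.1 (hV v)) (by simp) (by simp) h13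
    · have h0 : v0 ∉ allVerts ((v1, [v2], v3) :: (z1, m, w1) :: L) := fun h =>
        h4 (hmem v0 h h01 h02 h03 h0O)
      have hN' := List.nodup_cons.2 ⟨h0, hN⟩
      have hV : ∀ v, v ∈ v0 :: allVerts ((v1, [v2], v3) :: (z1, m, w1) :: L) := fun v =>
        List.mem_cons.2 (hcov0 v)
      have hp₁ : (v0 :: allVerts ((v1, [v2], v3) :: (z1, m, w1) :: L)).Perm
          (allVerts ((v0, [v3, v2], v1) :: (z1, m, w1) :: L)) := by
        simp only [allVerts, List.flatMap_cons, verts]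
        clear * -
        grind
      have hp₂ : (v0 :: allVerts ((v1, [v2], v3) :: (z1, m, w1) :: L)).Perm
          (allVerts ((v0, [v1, v2], v3) :: (z1, m, w1) :: L)) := by
        simp only [allVerts, List.flatMap_cons, verts]
        clear * -
        grind
      have hsing : ∀ a b c : V, ∀ K : List (Segment V),
          edges ((v0, [a, b], c) :: K) = insert s(v0, a) (edges ((a, [b], c) :: K)) := by
        intro a b c K
        simp [edges, verts, pathEdges]
      have hF₁ : T1 = edges ((v0, [v3, v2], v1) :: (z1, m, w1) :: L) := by
        rw [hsing, ← edges_cons_turn, Sym2.eq_swap]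
        exact hT1'
      have hF₂ : T2 = edges ((v0, [v1, v2], v3) :: (z1, m, w1) :: L) := by
        rw [hsing, hT2']
      rw [hF₁, hF₂]
      exact exists_completion_of_common_end (hp₁.nodup_iff.1 hN') (hp₂.nodup_iff.1 hN')
        (fun v => hp₁.mem_iff.1 (hV v)) (fun v => hp₂.mem_iff.1 (hV v)) (by simp) (by simp) h13
  · suffices h : ∃ B1 B2, CompletesToTours T1 T2 B1 B2 v1 z1 v3 w1 ∧
        IsPathPair (B1 ∪ B2) v1 v3 v4 v0 by
      obtain ⟨B1, B2, ⟨a1, a2, a3, a4, a5, a6, a7⟩, hP⟩ := h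
      exact ⟨B1, B2, a1, a2, a3, a4, a5, a6, a7, fun h => absurd h h04, fun _ => hP⟩
    have hV : ∀ v, v ∈ allVerts ((v1, [v2], v3) :: (z1, m, w1) :: L) := fun v => by
      rcases hcov4 v with rfl | h
      · exact (hcov0 v).resolve_left (Ne.symm h04)
      · exact h
    have hv4 := hmem v4 (hV v4) h14.symm h24.symm h34.symm h4O
    have hv0 := hmem v0 (hV v0) h01 h02 h03 h0O
    obtain ⟨x, q, L', hE, hp⟩ := exists_segment_ending hLN hv4 hdeg4
    rw [hE] at hv0 hdeg0
    have hN' := hp.nodup_iff.1 hLN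
    have hd0 : degE (pathEdges (verts (x, q, v4))) v0 ≤ 1 :=
      (degE_mono (by simp [edges]) v0).trans hdeg0
    have hd0' : degE (edges L') v0 ≤ 1 := (degE_mono (by simp [edges]) v0).trans hdeg0
    simp only [allVerts, List.flatMap_cons, List.nodup_append'] at hN'
    rw [edges, mem_VsetE_union, mem_VsetE_verts] at hv0
    rcases hv0 with hv0 | hv0
    · have hint : v0 ∉ q := fun h => by
        have := two_le_degE_interior hN'.1 h
        change 2 ≤ degE (pathEdges (verts (x, q, v4))) v0 at this
        omega
      have hx : v0 = x := by simpa [verts, hint, h04] using hv0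
      subst hx
      have hp₁ : (allVerts ((v1, [v2], v3) :: (z1, m, w1) :: L)).Perm
          (allVerts ((v0, q ++ [v4, v3, v2], v1) :: (z1, m, w1) :: L')) := by
        simp only [allVerts, List.flatMap_cons, verts] at hp ⊢
        clear * - hp
        grind
      have hp₂ : (allVerts ((v1, [v2], v3) :: (z1, m, w1) :: L)).Perm
          (allVerts ((v4, q.reverse ++ [v0, v1, v2], v3) :: (z1, m, w1) :: L')) := by
        have hq := q.reverse_perm
        simp only [allVerts, List.flatMap_cons, verts] at hp ⊢
        clear * - hp hq
        grind
      have hE' : edges ((v1, [v2], v3) :: (z1, m, w1) :: L) =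
          edges ((v1, [v2], v3) :: (v0, q, v4) :: (z1, m, w1) :: L') := by
        simp only [edges] at hE ⊢
        rw [hE, Finset.union_left_comm (pathEdges (verts (z1, m, w1)))]
      have hF₁ : T1 = edges ((v0, q ++ [v4, v3, v2], v1) :: (z1, m, w1) :: L') := by
        rw [edges_extend, ← edges_cons_turn, Sym2.eq_swap]
        exact hT1'.trans (congrArg _ hE')
      have hF₂ : T2 = edges ((v4, q.reverse ++ [v0, v1, v2], v3) :: (z1, m, w1) :: L') := by
        rw [edges_extend, hT2', hE', edges, ← edges_cons_turn (v0, q, v4)]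
        rfl
      rw [hF₁, hF₂]
      exact exists_completion_of_swapped_end (hp₁.nodup_iff.1 hN) (hp₂.nodup_iff.1 hN)
        (fun v => hp₁.mem_iff.1 (hV v)) (fun v => hp₂.mem_iff.1 (hV v)) (by simp) (by simp) h13
        h14 h03.symm (Ne.symm h04)
    · obtain ⟨y, p, L'', hE₂, hp'⟩ := exists_segment_ending hN'.2.1 hv0 hd0'
      have hp₁ : (allVerts ((v1, [v2], v3) :: (z1, m, w1) :: L)).Perm
          (allVerts ((x, q ++ [v4, v3, v2], v1) :: (y, p, v0) :: (z1, m, w1) :: L'')) := by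
        simp only [allVerts, List.flatMap_cons, verts] at hp hp' ⊢
        clear * - hp hp'
        grind
      have hp₂ : (allVerts ((v1, [v2], v3) :: (z1, m, w1) :: L)).Perm
          (allVerts ((y, p ++ [v0, v1, v2], v3) :: (x, q, v4) :: (z1, m, w1) :: L'')) := by
        simp only [allVerts, List.flatMap_cons, verts] at hp hp' ⊢
        clear * - hp hp'
        grind
      have hE' : edges ((v1, [v2], v3) :: (z1, m, w1) :: L) =
          edges ((v1, [v2], v3) :: (x, q, v4) :: (y, p, v0) :: (z1, m, w1) :: L'') := by
        simp only [edges] at hE hE₂ ⊢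
        rw [hE, hE₂, Finset.union_left_comm (pathEdges (verts (z1, m, w1))),
          Finset.union_left_comm (pathEdges (verts (z1, m, w1)))]
      have hF₁ : T1 =
          edges ((x, q ++ [v4, v3, v2], v1) :: (y, p, v0) :: (z1, m, w1) :: L'') := by
        rw [edges_extend, ← edges_cons_turn, Sym2.eq_swap]
        exact hT1'.trans (congrArg _ hE')
      have hF₂ : T2 =
          edges ((y, p ++ [v0, v1, v2], v3) :: (x, q, v4) :: (z1, m, w1) :: L'') := by
        rw [edges_extend, hT2', hE']
        exact congrArg _ (edges_perm ((List.Perm.swap _ _ _).cons _))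
      rw [hF₁, hF₂]
      exact exists_completion_of_two_segments (hp₁.nodup_iff.1 hN) (hp₂.nodup_iff.1 hN)
        (fun v => hp₁.mem_iff.1 (hV v)) (fun v => hp₂.mem_iff.1 (hV v)) (by simp) (by simp) h13
        h14 h03.symm (Ne.symm h04)
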